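/- arXiv:2204.01362 — 3 statements merged into one kernel-verified Lean document; each statement's English description precedes it below -/
import Mathlib

section
/- Let S be a ring with enough idempotents, let {e_i}_{i∈I} be a strong complete set of idempotents for S, and suppose S_{ij} = e_i S e_j ≠ {0} for some i,j ∈ I. Then the poset of left ideals of the corner ring S_i = e_i S e_i is order-isomorphic to the poset of left S_j-submodules of S_{ji} = e_j S e_i (where S_j = e_j S e_j is a unital ring with identity e_j acting on S_{ji} by left multiplication); an isomorphism is given by I ↦ e_j S I with inverse M ↦ e_i S M. -/
open CategoryTheory

namespace ChainPaper

section NonUnital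

variable {S : Type*} [NonUnitalRing S]

/-- The additive subgroup `e S f = {e * s * f | s ∈ S}` of a non-unital ring `S`. -/
def corner (e f : S) : AddSubgroup S :=
  ((AddMonoidHom.mulLeft e).comp (AddMonoidHom.mulRight f)).range

/-- The additive subgroup `S e = {s * e | s ∈ S}`. -/
def rightMulRange (e : S) : AddSubgroup S := (AddMonoidHom.mulRight e).range

/-- The additive subgroup `e S = {e * s | s ∈ S}`. -/
def leftMulRange (e : S) : AddSubgroup S := (AddMonoidHom.mulLeft e).range

/-- The product of two additive subgroups of a ring: the additive subgroup generated by
all products `a * b` with `a ∈ A`, `b ∈ B`. -/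
def sMul (A B : AddSubgroup S) : AddSubgroup S :=
  AddSubgroup.closure {x | ∃ a ∈ A, ∃ b ∈ B, x = a * b}

/-- `I` is a left ideal of the (possibly non-unital) subring whose carrier is
the additive subgroup `C` (closed under multiplication). -/
def IsLeftIdealIn (C I : AddSubgroup S) : Prop :=
  I ≤ C ∧ ∀ s ∈ C, ∀ x ∈ I, s * x ∈ I

def IsRightIdealIn (C I : AddSubgroup S) : Prop :=
  I ≤ C ∧ ∀ s ∈ C, ∀ x ∈ I, x * s ∈ I

/-- `M` is a left `C`-submodule of `H` (both viewed inside the ambient ring `S`,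
with `C` acting by left multiplication). -/
def IsLeftSubmoduleIn (C H M : AddSubgroup S) : Prop :=
  M ≤ H ∧ ∀ s ∈ C, ∀ x ∈ M, s * x ∈ M

def IsRightSubmoduleIn (C H M : AddSubgroup S) : Prop :=
  M ≤ H ∧ ∀ s ∈ C, ∀ x ∈ M, x * s ∈ M

/-- The descending chain condition on the subcollection of additive subgroups of `S`
cut out by the predicate `P`. -/
def DCCOn (P : AddSubgroup S → Prop) : Prop :=
  ∀ f : ℕ → AddSubgroup S, (∀ n, P (f n)) → (∀ n, f (n + 1) ≤ f n) →
    ∃ n, ∀ m, n ≤ m → f m = f n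

/-- The ascending chain condition on the subcollection of additive subgroups of `S`
cut out by the predicate `P`. -/
def ACCOn (P : AddSubgroup S → Prop) : Prop :=
  ∀ f : ℕ → AddSubgroup S, (∀ n, P (f n)) → (∀ n, f n ≤ f (n + 1)) →
    ∃ n, ∀ m, n ≤ m → f m = f n

def LeftArtinianOn (C : AddSubgroup S) : Prop := DCCOn (IsLeftIdealIn C)
def RightArtinianOn (C : AddSubgroup S) : Prop := DCCOn (IsRightIdealIn C)
def LeftNoetherianOn (C : AddSubgroup S) : Prop := ACCOn (IsLeftIdealIn C)
def RightNoetherianOn (C : AddSubgroup S) : Prop := ACCOn (IsRightIdealIn C)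

end NonUnital

/-- A possibly non-unital ring is left artinian if its poset of left ideals
satisfies the descending chain condition. -/
def IsLeftArtinian (S : Type*) [NonUnitalRing S] : Prop := LeftArtinianOn (⊤ : AddSubgroup S)
def IsRightArtinian (S : Type*) [NonUnitalRing S] : Prop := RightArtinianOn (⊤ : AddSubgroup S)
def IsLeftNoetherian (S : Type*) [NonUnitalRing S] : Prop := LeftNoetherianOn (⊤ : AddSubgroup S)
def IsRightNoetherian (S : Type*) [NonUnitalRing S] : Prop := RightNoetherianOn (⊤ : AddSubgroup S)

section NonUnital2

variable {S : Type*} [NonUnitalRing S]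

/-- `{e i}_{i ∈ ι}` is a complete set of idempotents for `S`: the `e i` are nonzero
pairwise orthogonal idempotents and `S = ⊕ᵢ S eᵢ = ⊕ᵢ eᵢ S` as internal direct sums of
additive subgroups. -/
structure IsCompleteIdempotents {ι : Type*} (e : ι → S) : Prop where
  ne_zero : ∀ i, e i ≠ 0
  idem : ∀ i, e i * e i = e i
  orthogonal : ∀ i j, i ≠ j → e i * e j = 0
  indep_right : iSupIndep fun i => rightMulRange (e i)
  span_right : (⨆ i, rightMulRange (e i)) = ⊤
  indep_left : iSupIndep fun i => leftMulRange (e i)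
  span_left : (⨆ i, leftMulRange (e i)) = ⊤

/-- A complete set of idempotents is strong if for all `p q`, whenever one of
`eₚ S e_q` and `e_q S eₚ` is nonzero, then the other is nonzero and `eₚ ∈ (eₚ S e_q)(e_q S eₚ)`. -/
def IsStrongIdempotents {ι : Type*} (e : ι → S) : Prop :=
  ∀ p q : ι,
    (corner (e p) (e q) ≠ ⊥ ∨ corner (e q) (e p) ≠ ⊥) →
      corner (e p) (e q) ≠ ⊥ ∧ corner (e q) (e p) ≠ ⊥ ∧
        e p ∈ sMul (corner (e p) (e q)) (corner (e q) (e p))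

/-- `H` is finitely generated as a left module over `C` (inside the ambient ring `S`,
`C` acting by left multiplication). -/
def IsFGLeftModuleIn (C H : AddSubgroup S) : Prop :=
  ∃ F : Finset S, ↑F ⊆ (H : Set S) ∧
    ∀ x ∈ H, x ∈ sInf {M : AddSubgroup S | ↑F ⊆ (M : Set S) ∧ ∀ s ∈ C, ∀ y ∈ M, s * y ∈ M}

def IsFGRightModuleIn (C H : AddSubgroup S) : Prop :=
  ∃ F : Finset S, ↑F ⊆ (H : Set S) ∧
    ∀ x ∈ H, x ∈ sInf {M : AddSubgroup S | ↑F ⊆ (M : Set S) ∧ ∀ s ∈ C, ∀ y ∈ M, y * s ∈ M}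

end NonUnital2

/-- A small category `G` is hom-set strong if for all objects `x y`, whenever one of
`G(x,y)` and `G(y,x)` is nonempty (here `G(x,y)` denotes the set of morphisms `y → x`),
then the other is nonempty and `𝟙 x ∈ G(x,y)G(y,x)`. -/
def HomSetStrong (G : Type*) [Category G] : Prop :=
  ∀ x y : G, (Nonempty (y ⟶ x) ∨ Nonempty (x ⟶ y)) →
    Nonempty (y ⟶ x) ∧ Nonempty (x ⟶ y) ∧ ∃ (g : y ⟶ x) (h : x ⟶ y), h ≫ g = 𝟙 x

/-- An object unital grading of the (possibly non-unital) ring `S` by the small category `G`: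
`S = ⊕_{g ∈ G₁} S_g` with `S_g S_h ⊆ S_{g ∘ h}` for composable morphisms, `S_g S_h = 0` for
non-composable ones, and each `S_a` (`a ∈ G₀`) is unital and nonzero with identity `one a`
acting as claimed. The component at a morphism `g : a ⟶ b` (in Mathlib's arrow direction) is
`comp g`, and products follow the paper's convention `S_g S_h ⊆ S_{gh}` where `gh` denotes
`h ≫ g`. -/
structure ObjectUnitalGrading (G : Type*) [Category G] (S : Type*) [NonUnitalRing S] where
  comp : ∀ {a b : G}, (a ⟶ b) → AddSubgroup S
  indep : iSupIndep fun p : Σ a : G, Σ b : G, a ⟶ b => comp p.2.2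
  span : (⨆ p : Σ a : G, Σ b : G, a ⟶ b, comp p.2.2) = ⊤
  mul_mem : ∀ {a b c : G} (g : b ⟶ c) (h : a ⟶ b) {x y : S},
    x ∈ comp g → y ∈ comp h → x * y ∈ comp (h ≫ g)
  mul_eq_zero : ∀ {a b a' b' : G} (g : a ⟶ b) (h : a' ⟶ b') {x y : S},
    x ∈ comp g → y ∈ comp h → b' ≠ a → x * y = 0
  one : G → S
  one_mem : ∀ a : G, one a ∈ comp (𝟙 a)
  one_ne_zero : ∀ a : G, one a ≠ 0
  one_mul_mem : ∀ {a b : G} (g : a ⟶ b), ∀ x ∈ comp g, one b * x = x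
  mul_one_mem : ∀ {a b : G} (g : a ⟶ b), ∀ x ∈ comp g, x * one a = x

namespace ObjectUnitalGrading

variable {G : Type*} [Category G] {S : Type*} [NonUnitalRing S]

/-- `E.hom a b = S_{G(b,a)}`, the sum of the components of all morphisms `a ⟶ b`. -/
def hom (E : ObjectUnitalGrading G S) (a b : G) : AddSubgroup S :=
  ⨆ g : a ⟶ b, E.comp g

/-- The grading is strong: `S_g S_h = S_{gh}` for all composable `g, h`. -/
def IsStronglyGraded (E : ObjectUnitalGrading G S) : Prop :=
  ∀ {a b c : G} (g : b ⟶ c) (h : a ⟶ b), sMul (E.comp g) (E.comp h) = E.comp (h ≫ g)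

/-- The grading is hom-set strong: for all objects `p q`, whenever one of `S_{G(p,q)}`
and `S_{G(q,p)}` is nonzero, the other is nonzero and `1_{S_p} ∈ S_{G(p,q)} S_{G(q,p)}`. -/
def IsHomSetStronglyGraded (E : ObjectUnitalGrading G S) : Prop :=
  ∀ p q : G, (E.hom q p ≠ ⊥ ∨ E.hom p q ≠ ⊥) →
    E.hom q p ≠ ⊥ ∧ E.hom p q ≠ ⊥ ∧ E.one p ∈ sMul (E.hom q p) (E.hom p q)

end ObjectUnitalGrading

/-- A group `H` is polycyclic-by-finite if it has a finite length subnormal series with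
each factor a finite group or an infinite cyclic group. -/
def IsPolycyclicByFinite (H : Type*) [Group H] : Prop :=
  ∃ (n : ℕ) (c : Fin (n + 1) → Subgroup H),
    c 0 = ⊥ ∧ c (Fin.last n) = ⊤ ∧
      ∀ i : Fin n,
        c i.castSucc ≤ c i.succ ∧
        ∃ _ : ((c i.castSucc).subgroupOf (c i.succ)).Normal,
          Finite ((c i.succ) ⧸ (c i.castSucc).subgroupOf (c i.succ)) ∨
            (Infinite ((c i.succ) ⧸ (c i.castSucc).subgroupOf (c i.succ)) ∧
              IsCyclic ((c i.succ) ⧸ (c i.castSucc).subgroupOf (c i.succ)))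

/-- Data exhibiting the non-unital ring `A` as the category algebra `T[G]`: an additive
isomorphism with the free `T`-module on the set of morphisms of `G`, matching the
multiplication `(t g)(u h) = (t u)(gh)` for composable `g, h` (where `gh = h ≫ g`) and
`(t g)(u h) = 0` otherwise. -/
structure CategoryAlgebraIso (T : Type*) [Ring T] (G : Type*) [Category G]
    (A : Type*) [NonUnitalRing A] where
  equiv : ((Σ a : G, Σ b : G, a ⟶ b) →₀ T) ≃+ A
  mul_single_comp : ∀ {a b c : G} (g : b ⟶ c) (h : a ⟶ b) (t u : T),
    equiv (Finsupp.single ⟨b, c, g⟩ t) * equiv (Finsupp.single ⟨a, b, h⟩ u) =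
      equiv (Finsupp.single ⟨a, c, h ≫ g⟩ (t * u))
  mul_single_ne : ∀ {a b a' b' : G} (g : a ⟶ b) (h : a' ⟶ b') (t u : T), b' ≠ a →
    equiv (Finsupp.single ⟨a, b, g⟩ t) * equiv (Finsupp.single ⟨a', b', h⟩ u) = 0

/-- Data exhibiting the non-unital ring `A` as the skew category algebra `R *_α G`: an
additive isomorphism with the direct sum `⊕_{g ∈ G₁} R_{c(g)}`, matching the multiplication
`(r g)(r' h) = (r · α_g(r')) (gh)` for composable `g, h` (where `gh = h ≫ g`) and
`(r g)(r' h) = 0` otherwise. -/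
structure SkewCategoryAlgebraIso (G : Type*) [Category G]
    [DecidableEq (Σ a : G, Σ b : G, a ⟶ b)]
    (R : G → Type*) [∀ a, Ring (R a)]
    (α : ∀ ⦃a b : G⦄, (a ⟶ b) → (R a →+* R b))
    (A : Type*) [NonUnitalRing A] where
  equiv : (Π₀ p : Σ a : G, Σ b : G, a ⟶ b, R p.2.1) ≃+ A
  mul_single_comp : ∀ {a b c : G} (g : b ⟶ c) (h : a ⟶ b) (r : R c) (r' : R b),
    equiv (DFinsupp.single ⟨b, c, g⟩ r) * equiv (DFinsupp.single ⟨a, b, h⟩ r') =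
      equiv (DFinsupp.single ⟨a, c, h ≫ g⟩ (r * α g r'))
  mul_single_ne : ∀ {a b a' b' : G} (g : a ⟶ b) (h : a' ⟶ b') (r : R b) (r' : R b'),
    b' ≠ a →
      equiv (DFinsupp.single ⟨a, b, g⟩ r) * equiv (DFinsupp.single ⟨a', b', h⟩ r') = 0


section CornerProducts

variable {S : Type*} [NonUnitalRing S]

theorem mem_corner {e f x : S} : x ∈ corner e f ↔ ∃ s, e * (s * f) = x := Iff.rfl

theorem mem_leftMulRange {e x : S} : x ∈ leftMulRange e ↔ ∃ s, e * s = x := Iff.rfl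

theorem mul_mem_sMul {A B : AddSubgroup S} {a b : S} (ha : a ∈ A) (hb : b ∈ B) :
    a * b ∈ sMul A B :=
  AddSubgroup.subset_closure ⟨a, ha, b, hb, rfl⟩

theorem sMul_le {A B C : AddSubgroup S} :
    sMul A B ≤ C ↔ ∀ a ∈ A, ∀ b ∈ B, a * b ∈ C := by
  refine ⟨fun h a ha b hb => h (mul_mem_sMul ha hb), fun h => ?_⟩
  refine (AddSubgroup.closure_le C).2 ?_
  rintro _ ⟨a, ha, b, hb, rfl⟩
  exact h a ha b hb

theorem sMul_mono_right {A B B' : AddSubgroup S} (h : B ≤ B') : sMul A B ≤ sMul A B' :=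
  sMul_le.2 fun _ ha _ hb => mul_mem_sMul ha (h hb)

theorem corner_le_leftMulRange (e f : S) : corner e f ≤ leftMulRange e := by
  rintro _ ⟨s, rfl⟩
  exact ⟨s * f, rfl⟩

theorem mul_eq_of_mem_corner {a c x : S} (ha : a * a = a) (hx : x ∈ corner a c) :
    a * x = x := by
  obtain ⟨s, rfl⟩ := mem_corner.1 hx
  rw [← mul_assoc, ha]

/-- For a submodule `M` of `b S c`, the product `a S M` is a submodule of `a S c`. -/
theorem isLeftSubmoduleIn_sMul {a b c : S} {M : AddSubgroup S} (hM : M ≤ corner b c) :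
    IsLeftSubmoduleIn (corner a a) (corner a c) (sMul (leftMulRange a) M) := by
  refine ⟨sMul_le.2 ?_, fun s hs x hx => ?_⟩
  · intro x hx m hm
    obtain ⟨u, rfl⟩ := mem_leftMulRange.1 hx
    obtain ⟨v, rfl⟩ := mem_corner.1 (hM hm)
    exact mem_corner.2 ⟨u * b * v, by simp only [mul_assoc]⟩
  · suffices h : sMul (leftMulRange a) M ≤
        (sMul (leftMulRange a) M).comap (AddMonoidHom.mulLeft s) from h hx
    refine sMul_le.2 fun y _ m hm => ?_
    change s * (y * m) ∈ sMul (leftMulRange a) M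
    obtain ⟨u, rfl⟩ := mem_corner.1 hs
    rw [← mul_assoc]
    exact mul_mem_sMul (mem_leftMulRange.2 ⟨u * a * y, by simp only [mul_assoc]⟩) hm

/-- If `a ∈ (a S b) (b S a)` then `a S (b S M) = M` for every submodule `M` of `a S c`. -/
theorem sMul_sMul_eq_self {a b c : S} (ha : a * a = a)
    (hab : a ∈ sMul (corner a b) (corner b a)) {M : AddSubgroup S}
    (hM : IsLeftSubmoduleIn (corner a a) (corner a c) M) :
    sMul (leftMulRange a) (sMul (leftMulRange b) M) = M := by
  apply le_antisymm
  · refine sMul_le.2 fun x hx y hy => ?_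
    suffices h : sMul (leftMulRange b) M ≤ M.comap (AddMonoidHom.mulLeft x) from h hy
    refine sMul_le.2 fun z _ m hm => ?_
    change x * (z * m) ∈ M
    obtain ⟨u, rfl⟩ := mem_leftMulRange.1 hx
    have key := hM.2 (a * (u * z * a)) (mem_corner.2 ⟨u * z, rfl⟩) m hm
    simpa only [mul_assoc, mul_eq_of_mem_corner ha (hM.1 hm)] using key
  · intro m hm
    suffices h : sMul (corner a b) (corner b a) ≤
        (sMul (leftMulRange a) (sMul (leftMulRange b) M)).comap (AddMonoidHom.mulRight m) by
      have key : a * m ∈ sMul (leftMulRange a) (sMul (leftMulRange b) M) := h hab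
      rwa [mul_eq_of_mem_corner ha (hM.1 hm)] at key
    refine sMul_le.2 fun x hx y hy => ?_
    change x * y * m ∈ sMul (leftMulRange a) (sMul (leftMulRange b) M)
    rw [mul_assoc]
    exact mul_mem_sMul (corner_le_leftMulRange _ _ hx)
      (mul_mem_sMul (corner_le_leftMulRange _ _ hy) hm)

end CornerProducts

theorem statement_3 {S : Type*} [NonUnitalRing S] {ι : Type*} (e : ι → S)
    (he : IsCompleteIdempotents e) (hs : IsStrongIdempotents e)
    (i j : ι) (hij : corner (e i) (e j) ≠ ⊥) :
    ∃ φ : {I : AddSubgroup S // IsLeftIdealIn (corner (e i) (e i)) I} ≃o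
        {M : AddSubgroup S // IsLeftSubmoduleIn (corner (e j) (e j)) (corner (e j) (e i)) M},
      (∀ I, (φ I : AddSubgroup S) = sMul (leftMulRange (e j)) (I : AddSubgroup S)) ∧
      (∀ M, (φ.symm M : AddSubgroup S) = sMul (leftMulRange (e i)) (M : AddSubgroup S)) := by
  obtain ⟨-, hji, hi⟩ := hs i j (Or.inl hij)
  obtain ⟨-, -, hj⟩ := hs j i (Or.inl hji)
  exact
    ⟨{ toFun := fun I => ⟨sMul (leftMulRange (e j)) I, isLeftSubmoduleIn_sMul I.2.1⟩
       invFun := fun M => ⟨sMul (leftMulRange (e i)) M, isLeftSubmoduleIn_sMul M.2.1⟩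
       left_inv := fun I => Subtype.ext (sMul_sMul_eq_self (he.idem i) hi I.2)
       right_inv := fun M => Subtype.ext (sMul_sMul_eq_self (he.idem j) hj M.2)
       map_rel_iff' := by
        intro I J
        refine ⟨fun h => ?_, fun h => sMul_mono_right h⟩
        have key := sMul_mono_right (A := leftMulRange (e i)) h
        change sMul _ (sMul _ _) ≤ sMul _ (sMul _ _) at key
        rwa [sMul_sMul_eq_self (he.idem i) hi I.2,
          sMul_sMul_eq_self (he.idem i) hi J.2] at key },
      fun _ => rfl, fun _ => rfl⟩

end ChainPaper
end

section
/- Let S be a ring with enough idempotents and let {e_i}_{i∈I} be a finite strong complete set of idempotents for S. If for every i ∈ I the corner ring S_i = e_i S e_i is left (respectively right) artinian, then S is left (respectively right) artinian; the same holds with 'artinian' replaced by 'noetherian'. -/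
open CategoryTheory

namespace ChainPaper

section ChainConditions

variable {S : Type*} [NonUnitalRing S]

/-- Every sequence of members of `P` in which consecutive terms are related by `r` stabilizes. -/
def ChainConditionOn (r : AddSubgroup S → AddSubgroup S → Prop) (P : AddSubgroup S → Prop) :
    Prop :=
  ∀ f : ℕ → AddSubgroup S, (∀ n, P (f n)) → (∀ n, r (f n) (f (n + 1))) →
    ∃ n, ∀ m, n ≤ m → f m = f n

lemma ChainConditionOn.mono {r : AddSubgroup S → AddSubgroup S → Prop}
    {P Q : AddSubgroup S → Prop} (h : ChainConditionOn r Q) (hPQ : ∀ M, P M → Q M) :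
    ChainConditionOn r P :=
  fun f hf hr => h f (fun n => hPQ _ (hf n)) hr

/-- An inclusion of subgroups with the same image and the same kernel under a homomorphism
is an equality. -/
lemma eq_of_le_of_map_eq_of_inf_ker_eq {A B : AddSubgroup S} (φ : S →+ S) (hle : A ≤ B)
    (hmap : A.map φ = B.map φ) (hker : A ⊓ φ.ker = B ⊓ φ.ker) : A = B := by
  refine le_antisymm hle fun x hx => ?_
  have hφx : φ x ∈ A.map φ := hmap ▸ AddSubgroup.mem_map_of_mem φ hx
  obtain ⟨y, hy, hxy⟩ := hφx
  have hsub : x - y ∈ A ⊓ φ.ker := by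
    rw [hker]
    exact ⟨B.sub_mem hx (hle hy), by simp [hxy]⟩
  simpa using A.add_mem hsub.1 hy

/-- A chain condition holds on `P` as soon as it holds on the images of the members of `P` under
finitely many homomorphisms with trivial joint kernel. -/
lemma ChainConditionOn.of_jointly_injective {r : AddSubgroup S → AddSubgroup S → Prop}
    (hr : r = (· ≤ ·) ∨ r = (· ≥ ·)) {P : AddSubgroup S → Prop} {T : Set (S →+ S)}
    (hT : T.Finite) (hinj : ∀ x, (∀ φ ∈ T, φ x = 0) → x = 0)
    (hker : ∀ φ ∈ T, ∀ M, P M → P (M ⊓ φ.ker))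
    (hmap : ∀ φ ∈ T, ∃ Q, ChainConditionOn r Q ∧ ∀ M, P M → Q (M.map φ)) :
    ChainConditionOn r P := by
  suffices h : ChainConditionOn r fun M => P M ∧ ∀ x ∈ M, (∀ φ ∈ T, φ x = 0) → x = 0 from
    h.mono fun M hM => ⟨hM, fun x _ => hinj x⟩
  clear hinj
  induction T, hT using Set.Finite.induction_on with
  | empty =>
    intro f hf _
    have hbot : ∀ n, f n = ⊥ := fun n =>
      (AddSubgroup.eq_bot_iff_forall _).2 fun x hx => (hf n).2 x hx (by simp)
    exact ⟨0, fun m _ => by rw [hbot, hbot]⟩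
  | @insert φ T _ _ ih =>
    intro f hf hfr
    have ih' := ih (fun ψ hψ => hker ψ (Set.mem_insert_of_mem _ hψ))
      (fun ψ hψ => hmap ψ (Set.mem_insert_of_mem _ hψ))
    obtain ⟨Q, hQ, hPQ⟩ := hmap φ (Set.mem_insert _ _)
    obtain ⟨a, ha⟩ := hQ (fun n => (f n).map φ) (fun n => hPQ _ (hf n).1) fun n => by
      rcases hr with rfl | rfl <;> exact AddSubgroup.map_mono (hfr n)
    obtain ⟨b, hb⟩ := ih' (fun n => f n ⊓ φ.ker)
      (fun n => ⟨hker φ (Set.mem_insert _ _) _ (hf n).1, fun x hx h0 =>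
        (hf n).2 x hx.1 (by simpa using ⟨hx.2, h0⟩)⟩) fun n => by
      rcases hr with rfl | rfl <;> exact inf_le_inf_right _ (hfr n)
    refine ⟨max a b, fun m hm => ?_⟩
    have hmapeq : (f m).map φ = (f (max a b)).map φ :=
      (ha m (by omega)).trans (ha _ (le_max_left _ _)).symm
    have hkereq : f m ⊓ φ.ker = f (max a b) ⊓ φ.ker :=
      (hb m (by omega)).trans (hb _ (le_max_right _ _)).symm
    rcases hr with rfl | rfl
    · exact (eq_of_le_of_map_eq_of_inf_ker_eq φ (monotone_nat_of_le_succ hfr hm)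
        hmapeq.symm hkereq.symm).symm
    · exact eq_of_le_of_map_eq_of_inf_ker_eq φ (antitone_nat_of_succ_le hfr hm) hmapeq hkereq

end ChainConditions

section Corners

variable {S : Type*} [NonUnitalRing S]

lemma mul_mul_mem_corner (e f s : S) : e * s * f ∈ corner e f := ⟨s, (mul_assoc e s f).symm⟩

lemma mul_eq_of_mem_corner_left {e f x : S} (he : e * e = e) (hx : x ∈ corner e f) :
    e * x = x := by
  obtain ⟨s, rfl⟩ := hx
  change e * (e * (s * f)) = e * (s * f)
  rw [← mul_assoc, he]

lemma mul_eq_of_mem_corner_right {e f x : S} (hf : f * f = f) (hx : x ∈ corner e f) :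
    x * f = x := by
  obtain ⟨s, rfl⟩ := hx
  change e * (s * f) * f = e * (s * f)
  rw [mul_assoc, mul_assoc, hf]

lemma mem_corner_iff {e f x : S} (he : e * e = e) (hf : f * f = f) :
    x ∈ corner e f ↔ e * x = x ∧ x * f = x := by
  refine ⟨fun hx => ⟨mul_eq_of_mem_corner_left he hx, mul_eq_of_mem_corner_right hf hx⟩, ?_⟩
  rintro ⟨h₁, h₂⟩
  rw [← h₂, ← h₁]
  exact mul_mul_mem_corner e f x

lemma exists_finite_forall_mul_eq_zero_left {A B : AddSubgroup S} {y : S} (hy : y ∈ sMul A B) :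
    ∃ F : Set S, F.Finite ∧ F ⊆ A ∧ ∀ z, (∀ a ∈ F, z * a = 0) → z * y = 0 := by
  induction hy using AddSubgroup.closure_induction with
  | mem x hx =>
    obtain ⟨a, ha, b, -, rfl⟩ := hx
    refine ⟨{a}, Set.finite_singleton a, by simpa using ha, fun z hz => ?_⟩
    rw [← mul_assoc, hz a rfl, zero_mul]
  | zero => exact ⟨∅, Set.finite_empty, Set.empty_subset _, fun z _ => mul_zero z⟩
  | add x y _ _ hx hy =>
    obtain ⟨F, hF, hFA, hFx⟩ := hx
    obtain ⟨G, hG, hGA, hGy⟩ := hy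
    refine ⟨F ∪ G, hF.union hG, Set.union_subset hFA hGA, fun z hz => ?_⟩
    rw [mul_add, hFx z fun a ha => hz a (.inl ha), hGy z fun a ha => hz a (.inr ha), add_zero]
  | neg x _ hx =>
    obtain ⟨F, hF, hFA, hFx⟩ := hx
    exact ⟨F, hF, hFA, fun z hz => by rw [mul_neg, hFx z hz, neg_zero]⟩

lemma exists_finite_forall_mul_eq_zero_right {A B : AddSubgroup S} {y : S} (hy : y ∈ sMul A B) :
    ∃ F : Set S, F.Finite ∧ F ⊆ B ∧ ∀ z, (∀ b ∈ F, b * z = 0) → y * z = 0 := by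
  induction hy using AddSubgroup.closure_induction with
  | mem x hx =>
    obtain ⟨a, -, b, hb, rfl⟩ := hx
    refine ⟨{b}, Set.finite_singleton b, by simpa using hb, fun z hz => ?_⟩
    rw [mul_assoc, hz b rfl, mul_zero]
  | zero => exact ⟨∅, Set.finite_empty, Set.empty_subset _, fun z _ => zero_mul z⟩
  | add x y _ _ hx hy =>
    obtain ⟨F, hF, hFA, hFx⟩ := hx
    obtain ⟨G, hG, hGA, hGy⟩ := hy
    refine ⟨F ∪ G, hF.union hG, Set.union_subset hFA hGA, fun z hz => ?_⟩
    rw [add_mul, hFx z fun a ha => hz a (.inl ha), hGy z fun a ha => hz a (.inr ha), add_zero]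
  | neg x _ hx =>
    obtain ⟨F, hF, hFA, hFx⟩ := hx
    exact ⟨F, hF, hFA, fun z hz => by rw [neg_mul, hFx z hz, neg_zero]⟩

end Corners

section CompleteIdempotents

variable {S : Type*} [NonUnitalRing S] {ι : Type*} {e : ι → S}

lemma IsCompleteIdempotents.mul_sum [Fintype ι] (he : IsCompleteIdempotents e) (x : S) :
    x * ∑ i, e i = x := by
  have hx : x ∈ ⨆ i, rightMulRange (e i) := he.span_right ▸ AddSubgroup.mem_top x
  induction hx using AddSubgroup.iSup_induction' with
  | hp j x hx =>
    obtain ⟨s, rfl⟩ := hx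
    change s * e j * _ = s * e j
    rw [mul_assoc, Finset.mul_sum, Finset.sum_eq_single j, he.idem]
    · exact fun k _ hk => he.orthogonal j k hk.symm
    · simp
  | h1 => simp
  | hadd x y _ _ hx hy => rw [add_mul, hx, hy]

lemma IsCompleteIdempotents.sum_mul [Fintype ι] (he : IsCompleteIdempotents e) (x : S) :
    (∑ i, e i) * x = x := by
  have hx : x ∈ ⨆ i, leftMulRange (e i) := he.span_left ▸ AddSubgroup.mem_top x
  induction hx using AddSubgroup.iSup_induction' with
  | hp j x hx =>
    obtain ⟨s, rfl⟩ := hx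
    change _ * (e j * s) = e j * s
    rw [← mul_assoc, Finset.sum_mul, Finset.sum_eq_single j, he.idem]
    · exact fun k _ hk => he.orthogonal k j hk
    · simp
  | h1 => simp
  | hadd x y _ _ hx hy => rw [mul_add, hx, hy]

lemma IsCompleteIdempotents.eq_zero_of_forall [Finite ι] (he : IsCompleteIdempotents e) {x : S}
    (hx : ∀ p q, e p * x * e q = 0) : x = 0 := by
  cases nonempty_fintype ι
  have h : ∀ p, e p * x = 0 := fun p => by
    rw [← he.mul_sum (e p * x), Finset.mul_sum]
    exact Finset.sum_eq_zero fun q _ => hx p q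
  rw [← he.sum_mul x, Finset.sum_mul]
  exact Finset.sum_eq_zero fun p _ => h p

lemma IsStrongIdempotents.exists_finite_left (hs : IsStrongIdempotents e)
    (p q : ι) :
    ∃ F : Set S, F.Finite ∧ F ⊆ corner (e q) (e p) ∧
      ∀ x, (∀ a ∈ F, e p * x * a = 0) → e p * x * e q = 0 := by
  by_cases h : corner (e p) (e q) = ⊥
  · refine ⟨∅, Set.finite_empty, Set.empty_subset _, fun x _ => ?_⟩
    have hx := mul_mul_mem_corner (e p) (e q) x
    rwa [h, AddSubgroup.mem_bot] at hx
  · obtain ⟨F, hF, hFA, hz⟩ := exists_finite_forall_mul_eq_zero_left (hs q p (.inr h)).2.2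
    exact ⟨F, hF, hFA, fun x hx => hz _ hx⟩

lemma IsStrongIdempotents.exists_finite_right (hs : IsStrongIdempotents e)
    (p q : ι) :
    ∃ F : Set S, F.Finite ∧ F ⊆ corner (e q) (e p) ∧
      ∀ x, (∀ b ∈ F, b * (x * e q) = 0) → e p * x * e q = 0 := by
  by_cases h : corner (e p) (e q) = ⊥
  · refine ⟨∅, Set.finite_empty, Set.empty_subset _, fun x _ => ?_⟩
    have hx := mul_mul_mem_corner (e p) (e q) x
    rwa [h, AddSubgroup.mem_bot] at hx
  · obtain ⟨F, hF, hFA, hz⟩ := exists_finite_forall_mul_eq_zero_right (hs p q (.inl h)).2.2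
    exact ⟨F, hF, hFA, fun x hx => by rw [mul_assoc]; exact hz _ hx⟩

lemma IsStrongIdempotents.chainConditionOn_left [Finite ι] (he : IsCompleteIdempotents e)
    (hs : IsStrongIdempotents e) {r : AddSubgroup S → AddSubgroup S → Prop}
    (hr : r = (· ≤ ·) ∨ r = (· ≥ ·))
    (h : ∀ i, ChainConditionOn r (IsLeftIdealIn (corner (e i) (e i)))) :
    ChainConditionOn r (IsLeftIdealIn (⊤ : AddSubgroup S)) := by
  choose F hF hFc hF0 using fun p q => hs.exists_finite_left p q
  let φ : ι → S → S →+ S := fun p a =>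
    (AddMonoidHom.mulRight a).comp (AddMonoidHom.mulLeft (e p))
  have hφ : ∀ p a x, φ p a x = e p * x * a := fun _ _ _ => rfl
  refine (ChainConditionOn.of_jointly_injective hr
    (P := fun M => ∀ p, ∀ s ∈ corner (e p) (e p), ∀ x ∈ M, s * x ∈ M)
    (T := ⋃ p, ⋃ q, φ p '' F p q)
    (Set.finite_iUnion fun p => Set.finite_iUnion fun q => (hF p q).image _) ?_ ?_ ?_).mono
    fun M hM p s _ => hM.2 s trivial
  · intro x hx
    refine he.eq_zero_of_forall fun p q => hF0 p q x fun a ha => ?_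
    exact hx (φ p a) (Set.mem_iUnion₂.2 ⟨p, q, a, ha, rfl⟩)
  · intro ψ hψ M hM q s hsq x hx
    obtain ⟨p, -, a, -, rfl⟩ := Set.mem_iUnion₂.1 hψ
    refine ⟨hM q s hsq x hx.1, ?_⟩
    have hx0 : e p * x * a = 0 := hx.2
    change e p * (s * x) * a = 0
    by_cases hpq : p = q
    · subst hpq
      obtain ⟨h₁, h₂⟩ := (mem_corner_iff (he.idem p) (he.idem p)).1 hsq
      calc e p * (s * x) * a = e p * s * x * a := by simp only [mul_assoc]
        _ = s * e p * x * a := by rw [h₁, h₂]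
        _ = s * (e p * x * a) := by simp only [mul_assoc]
        _ = 0 := by rw [hx0, mul_zero]
    · rw [← mul_eq_of_mem_corner_left (he.idem q) hsq, mul_assoc (e q), ← mul_assoc (e p),
        he.orthogonal p q hpq, zero_mul, zero_mul]
  · intro ψ hψ
    obtain ⟨p, q, a, ha, rfl⟩ := Set.mem_iUnion₂.1 hψ
    have hap := mul_eq_of_mem_corner_right (he.idem p) (hFc p q ha)
    refine ⟨_, h p, fun M hM => ⟨?_, ?_⟩⟩
    · rintro _ ⟨x, -, rfl⟩
      rw [hφ, ← hap, ← mul_assoc, mul_assoc (e p)]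
      exact mul_mul_mem_corner _ _ _
    · rintro s hsp _ ⟨x, hx, rfl⟩
      refine ⟨s * x, hM p s hsp x hx, ?_⟩
      obtain ⟨h₁, h₂⟩ := (mem_corner_iff (he.idem p) (he.idem p)).1 hsp
      calc e p * (s * x) * a = e p * s * x * a := by simp only [mul_assoc]
        _ = s * e p * x * a := by rw [h₁, h₂]
        _ = s * (e p * x * a) := by simp only [mul_assoc]

lemma IsStrongIdempotents.chainConditionOn_right [Finite ι] (he : IsCompleteIdempotents e)
    (hs : IsStrongIdempotents e) {r : AddSubgroup S → AddSubgroup S → Prop}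
    (hr : r = (· ≤ ·) ∨ r = (· ≥ ·))
    (h : ∀ i, ChainConditionOn r (IsRightIdealIn (corner (e i) (e i)))) :
    ChainConditionOn r (IsRightIdealIn (⊤ : AddSubgroup S)) := by
  choose F hF hFc hF0 using fun p q => hs.exists_finite_right p q
  let φ : ι → S → S →+ S := fun q b =>
    (AddMonoidHom.mulLeft b).comp (AddMonoidHom.mulRight (e q))
  have hφ : ∀ q b x, φ q b x = b * (x * e q) := fun _ _ _ => rfl
  refine (ChainConditionOn.of_jointly_injective hr
    (P := fun M => ∀ p, ∀ s ∈ corner (e p) (e p), ∀ x ∈ M, x * s ∈ M)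
    (T := ⋃ p, ⋃ q, φ q '' F p q)
    (Set.finite_iUnion fun p => Set.finite_iUnion fun q => (hF p q).image _) ?_ ?_ ?_).mono
    fun M hM p s _ => hM.2 s trivial
  · intro x hx
    refine he.eq_zero_of_forall fun p q => hF0 p q x fun b hb => ?_
    exact hx (φ q b) (Set.mem_iUnion₂.2 ⟨p, q, b, hb, rfl⟩)
  · intro ψ hψ M hM p s hsp x hx
    obtain ⟨-, q, b, -, rfl⟩ := Set.mem_iUnion₂.1 hψ
    refine ⟨hM p s hsp x hx.1, ?_⟩
    have hx0 : b * (x * e q) = 0 := hx.2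
    change b * (x * s * e q) = 0
    by_cases hpq : p = q
    · subst hpq
      obtain ⟨h₁, h₂⟩ := (mem_corner_iff (he.idem p) (he.idem p)).1 hsp
      calc b * (x * s * e p) = b * (x * (s * e p)) := by simp only [mul_assoc]
        _ = b * (x * (e p * s)) := by rw [h₁, h₂]
        _ = b * (x * e p) * s := by simp only [mul_assoc]
        _ = 0 := by rw [hx0, zero_mul]
    · rw [← mul_eq_of_mem_corner_right (he.idem p) hsp, ← mul_assoc x, mul_assoc _ (e p),
        he.orthogonal p q hpq, mul_zero, mul_zero]
  · intro ψ hψ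
    obtain ⟨p, q, b, hb, rfl⟩ := Set.mem_iUnion₂.1 hψ
    have hqb := mul_eq_of_mem_corner_left (he.idem q) (hFc p q hb)
    refine ⟨_, h q, fun M hM => ⟨?_, ?_⟩⟩
    · rintro _ ⟨x, -, rfl⟩
      rw [hφ, ← hqb, ← mul_assoc, mul_assoc (e q)]
      exact mul_mul_mem_corner _ _ _
    · rintro s hsq _ ⟨x, hx, rfl⟩
      refine ⟨x * s, hM q s hsq x hx, ?_⟩
      obtain ⟨h₁, h₂⟩ := (mem_corner_iff (he.idem q) (he.idem q)).1 hsq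
      calc b * (x * s * e q) = b * (x * (s * e q)) := by simp only [mul_assoc]
        _ = b * (x * (e q * s)) := by rw [h₁, h₂]
        _ = b * (x * e q) * s := by simp only [mul_assoc]

end CompleteIdempotents

theorem statement_5 {S : Type*} [NonUnitalRing S] {ι : Type*} (e : ι → S)
    (hfin : Finite ι) (he : IsCompleteIdempotents e) (hs : IsStrongIdempotents e) :
    ((∀ i, LeftArtinianOn (corner (e i) (e i))) → IsLeftArtinian S) ∧
    ((∀ i, RightArtinianOn (corner (e i) (e i))) → IsRightArtinian S) ∧
    ((∀ i, LeftNoetherianOn (corner (e i) (e i))) → IsLeftNoetherian S) ∧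
    ((∀ i, RightNoetherianOn (corner (e i) (e i))) → IsRightNoetherian S) :=
  ⟨fun h => hs.chainConditionOn_left he (.inr rfl) h,
    fun h => hs.chainConditionOn_right he (.inr rfl) h,
    fun h => hs.chainConditionOn_left he (.inl rfl) h,
    fun h => hs.chainConditionOn_right he (.inl rfl) h⟩

end ChainPaper
end

section
/- Let G be a small category and let S be an object unital G-graded ring. If S is left (respectively right) artinian, then G_0 is finite and for every a ∈ G_0 the ring S_{G(a)} is left (respectively right) artinian; the same holds with 'artinian' replaced by 'noetherian'. -/
open CategoryTheory

namespace ChainPaper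

section ChainConditions

variable {S : Type*} [NonUnitalRing S]

theorem DCCOn.of_leftInverse {P Q : AddSubgroup S → Prop} (h : DCCOn Q)
    (J : AddSubgroup S → AddSubgroup S) (C : AddSubgroup S) (hmono : Monotone J)
    (hJ : ∀ I, P I → Q (J I)) (hC : ∀ I, P I → J I ⊓ C = I) : DCCOn P := by
  intro f hf hle
  obtain ⟨n, hn⟩ := h (fun n => J (f n)) (fun n => hJ _ (hf n)) (fun n => hmono (hle n))
  refine ⟨n, fun m hm => ?_⟩
  rw [← hC _ (hf m), ← hC _ (hf n)]
  exact congrArg (· ⊓ C) (hn m hm)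

theorem ACCOn.of_leftInverse {P Q : AddSubgroup S → Prop} (h : ACCOn Q)
    (J : AddSubgroup S → AddSubgroup S) (C : AddSubgroup S) (hmono : Monotone J)
    (hJ : ∀ I, P I → Q (J I)) (hC : ∀ I, P I → J I ⊓ C = I) : ACCOn P := by
  intro f hf hle
  obtain ⟨n, hn⟩ := h (fun n => J (f n)) (fun n => hJ _ (hf n)) (fun n => hmono (hle n))
  refine ⟨n, fun m hm => ?_⟩
  rw [← hC _ (hf m), ← hC _ (hf n)]
  exact congrArg (· ⊓ C) (hn m hm)

theorem DCCOn.finite_of_mem_iff_ne {P : AddSubgroup S → Prop} (h : DCCOn P) {ι : Type*}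
    (e : ι → S) (K : ι → AddSubgroup S) (hK : ∀ i j, e i ∈ K j ↔ i ≠ j)
    (hP : ∀ s : Set ι, P (⨅ i ∈ s, K i)) : Finite ι := by
  by_contra hfin
  rw [not_finite_iff_infinite] at hfin
  let φ := Infinite.natEmbedding ι
  obtain ⟨n, hn⟩ := h (fun n => ⨅ i ∈ φ '' Set.Iio n, K i) (fun n => hP _)
    (fun n => biInf_mono (Set.image_mono (Set.Iio_subset_Iio n.le_succ)))
  have hmem : e (φ n) ∈ ⨅ i ∈ φ '' Set.Iio n, K i := by
    simp [AddSubgroup.mem_iInf, hK]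
    lia
  have hnot : e (φ n) ∉ ⨅ i ∈ φ '' Set.Iio (n + 1), K i := by
    simp [AddSubgroup.mem_iInf, hK]
  exact hnot ((hn (n + 1) n.le_succ).symm ▸ hmem)

theorem ACCOn.finite_of_mem_iff_ne {P : AddSubgroup S → Prop} (h : ACCOn P) {ι : Type*}
    (e : ι → S) (K : ι → AddSubgroup S) (hK : ∀ i j, e i ∈ K j ↔ i ≠ j)
    (hP : ∀ s : Set ι, P (⨅ i ∈ s, K i)) : Finite ι := by
  by_contra hfin
  rw [not_finite_iff_infinite] at hfin
  let φ := Infinite.natEmbedding ι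
  obtain ⟨n, hn⟩ := h (fun n => ⨅ i ∈ φ '' Set.Ici n, K i) (fun n => hP _)
    (fun n => biInf_mono (Set.image_mono (Set.Ici_subset_Ici.2 n.le_succ)))
  have hmem : e (φ n) ∈ ⨅ i ∈ φ '' Set.Ici (n + 1), K i := by
    simp [AddSubgroup.mem_iInf, hK]
    lia
  have hnot : e (φ n) ∉ ⨅ i ∈ φ '' Set.Ici n, K i := by
    simp [AddSubgroup.mem_iInf, hK]
  exact hnot (hn (n + 1) n.le_succ ▸ hmem)

/-- The elements annihilated by right multiplication by `e`. -/
def leftAnnihilator (e : S) : AddSubgroup S := (AddMonoidHom.mulRight e).ker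

/-- The elements annihilated by left multiplication by `e`. -/
def rightAnnihilator (e : S) : AddSubgroup S := (AddMonoidHom.mulLeft e).ker

theorem isLeftIdealIn_top_iInf_leftAnnihilator {ι : Type*} (e : ι → S) (s : Set ι) :
    IsLeftIdealIn ⊤ (⨅ i ∈ s, leftAnnihilator (e i)) := by
  refine ⟨le_top, fun t _ x hx => ?_⟩
  simp only [AddSubgroup.mem_iInf, leftAnnihilator, AddMonoidHom.mem_ker,
    AddMonoidHom.mulRight_apply] at hx ⊢
  intro i hi
  rw [mul_assoc, hx i hi, mul_zero]

theorem isRightIdealIn_top_iInf_rightAnnihilator {ι : Type*} (e : ι → S) (s : Set ι) :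
    IsRightIdealIn ⊤ (⨅ i ∈ s, rightAnnihilator (e i)) := by
  refine ⟨le_top, fun t _ x hx => ?_⟩
  simp only [AddSubgroup.mem_iInf, rightAnnihilator, AddMonoidHom.mem_ker,
    AddMonoidHom.coe_mulLeft] at hx ⊢
  intro i hi
  rw [← mul_assoc, hx i hi, zero_mul]

/-- The largest left ideal `J` of `S` with `e * J ⊆ I`, for an idempotent `e`. -/
def leftExtension (e : S) (I : AddSubgroup S) : AddSubgroup S :=
  ⨅ s : S, I.comap (AddMonoidHom.mulLeft (e * s))

/-- The largest right ideal `J` of `S` with `J * e ⊆ I`, for an idempotent `e`. -/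
def rightExtension (e : S) (I : AddSubgroup S) : AddSubgroup S :=
  ⨅ s : S, I.comap (AddMonoidHom.mulRight (s * e))

theorem mem_leftExtension {e : S} {I : AddSubgroup S} {x : S} :
    x ∈ leftExtension e I ↔ ∀ s, e * s * x ∈ I := by
  simp [leftExtension, AddSubgroup.mem_iInf]

theorem mem_rightExtension {e : S} {I : AddSubgroup S} {x : S} :
    x ∈ rightExtension e I ↔ ∀ s, x * (s * e) ∈ I := by
  simp [rightExtension, AddSubgroup.mem_iInf]

theorem leftExtension_mono (e : S) : Monotone (leftExtension e) := by
  intro I J h x hx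
  rw [mem_leftExtension] at hx ⊢
  exact fun s => h (hx s)

theorem rightExtension_mono (e : S) : Monotone (rightExtension e) := by
  intro I J h x hx
  rw [mem_rightExtension] at hx ⊢
  exact fun s => h (hx s)

theorem isLeftIdealIn_top_leftExtension (e : S) (I : AddSubgroup S) :
    IsLeftIdealIn ⊤ (leftExtension e I) := by
  refine ⟨le_top, fun t _ x hx => ?_⟩
  rw [mem_leftExtension] at hx ⊢
  intro s
  simpa only [mul_assoc] using hx (s * t)

theorem isRightIdealIn_top_rightExtension (e : S) (I : AddSubgroup S) :
    IsRightIdealIn ⊤ (rightExtension e I) := by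
  refine ⟨le_top, fun t _ x hx => ?_⟩
  rw [mem_rightExtension] at hx ⊢
  intro s
  simpa only [mul_assoc] using hx (t * s)

theorem leftExtension_inf {e : S} {C I : AddSubgroup S} (he : e * e = e)
    (hcorner : ∀ s, e * s * e ∈ C) (hleft : ∀ x ∈ C, e * x = x) (hI : IsLeftIdealIn C I) :
    leftExtension e I ⊓ C = I := by
  ext x
  rw [AddSubgroup.mem_inf, mem_leftExtension]
  constructor
  · rintro ⟨hx, hxC⟩
    simpa only [he, hleft x hxC] using hx e
  · intro hx
    refine ⟨fun s => ?_, hI.1 hx⟩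
    have h := hI.2 _ (hcorner s) x hx
    rwa [mul_assoc _ e x, hleft x (hI.1 hx)] at h

theorem rightExtension_inf {e : S} {C I : AddSubgroup S} (he : e * e = e)
    (hcorner : ∀ s, e * s * e ∈ C) (hright : ∀ x ∈ C, x * e = x) (hI : IsRightIdealIn C I) :
    rightExtension e I ⊓ C = I := by
  ext x
  rw [AddSubgroup.mem_inf, mem_rightExtension]
  constructor
  · rintro ⟨hx, hxC⟩
    simpa only [he, hright x hxC] using hx e
  · intro hx
    refine ⟨fun s => ?_, hI.1 hx⟩
    have h := hI.2 _ (hcorner s) x hx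
    rwa [mul_assoc e s e, ← mul_assoc x, hright x (hI.1 hx)] at h

end ChainConditions

namespace ObjectUnitalGrading

variable {G : Type*} [Category G] {S : Type*} [NonUnitalRing S] (E : ObjectUnitalGrading G S)

theorem one_mul_one_self (a : G) : E.one a * E.one a = E.one a :=
  E.one_mul_mem (𝟙 a) _ (E.one_mem a)

theorem one_mul_one_eq_zero {a b : G} (h : a ≠ b) : E.one a * E.one b = 0 :=
  E.mul_eq_zero (𝟙 a) (𝟙 b) (E.one_mem a) (E.one_mem b) h.symm

theorem one_mul_one_eq_zero_iff (a b : G) : E.one a * E.one b = 0 ↔ a ≠ b := by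
  refine ⟨?_, E.one_mul_one_eq_zero⟩
  rintro h rfl
  exact E.one_ne_zero a (E.one_mul_one_self a ▸ h)

theorem one_mem_leftAnnihilator_iff (a b : G) :
    E.one a ∈ leftAnnihilator (E.one b) ↔ a ≠ b :=
  E.one_mul_one_eq_zero_iff a b

theorem one_mem_rightAnnihilator_iff (a b : G) :
    E.one a ∈ rightAnnihilator (E.one b) ↔ a ≠ b :=
  (E.one_mul_one_eq_zero_iff b a).trans ne_comm

theorem one_mul_of_mem_hom {a b : G} {x : S} (hx : x ∈ E.hom a b) : E.one b * x = x := by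
  induction hx using AddSubgroup.iSup_induction' with
  | hp g x hx => exact E.one_mul_mem g x hx
  | h1 => exact mul_zero _
  | hadd x y _ _ hx hy => rw [mul_add, hx, hy]

theorem mul_one_of_mem_hom {a b : G} {x : S} (hx : x ∈ E.hom a b) : x * E.one a = x := by
  induction hx using AddSubgroup.iSup_induction' with
  | hp g x hx => exact E.mul_one_mem g x hx
  | h1 => exact zero_mul _
  | hadd x y _ _ hx hy => rw [add_mul, hx, hy]

theorem one_mul_mul_one_mem_hom (a b : G) (x : S) : E.one b * x * E.one a ∈ E.hom a b := by
  have hx : x ∈ ⨆ p : Σ a : G, Σ b : G, a ⟶ b, E.comp p.2.2 := E.span ▸ AddSubgroup.mem_top x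
  induction hx using AddSubgroup.iSup_induction' with
  | hp p x hx =>
    obtain ⟨c, d, g⟩ := p
    by_cases hd : d = b
    · subst hd
      rw [E.one_mul_mem g x hx]
      by_cases hc : a = c
      · subst hc
        rw [E.mul_one_mem g x hx]
        exact le_iSup (fun g : a ⟶ d => E.comp g) g hx
      · rw [E.mul_eq_zero g (𝟙 a) hx (E.one_mem a) hc]
        exact zero_mem _
    · rw [E.mul_eq_zero (𝟙 b) g (E.one_mem b) hx hd, zero_mul]
      exact zero_mem _
  | h1 => simp only [mul_zero, zero_mul, zero_mem]
  | hadd x y _ _ hx hy =>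
    rw [mul_add, add_mul]
    exact add_mem hx hy

theorem leftExtension_inf_hom (a : G) (I : AddSubgroup S) (hI : IsLeftIdealIn (E.hom a a) I) :
    leftExtension (E.one a) I ⊓ E.hom a a = I :=
  leftExtension_inf (E.one_mul_one_self a) (E.one_mul_mul_one_mem_hom a a)
    (fun _ => E.one_mul_of_mem_hom) hI

theorem rightExtension_inf_hom (a : G) (I : AddSubgroup S) (hI : IsRightIdealIn (E.hom a a) I) :
    rightExtension (E.one a) I ⊓ E.hom a a = I :=
  rightExtension_inf (E.one_mul_one_self a) (E.one_mul_mul_one_mem_hom a a)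
    (fun _ => E.mul_one_of_mem_hom) hI

end ObjectUnitalGrading

theorem statement_12 {G : Type*} [Category G] {S : Type*} [NonUnitalRing S]
    (E : ObjectUnitalGrading G S) :
    (IsLeftArtinian S → Finite G ∧ ∀ a : G, LeftArtinianOn (E.hom a a)) ∧
    (IsRightArtinian S → Finite G ∧ ∀ a : G, RightArtinianOn (E.hom a a)) ∧
    (IsLeftNoetherian S → Finite G ∧ ∀ a : G, LeftNoetherianOn (E.hom a a)) ∧
    (IsRightNoetherian S → Finite G ∧ ∀ a : G, RightNoetherianOn (E.hom a a)) := by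
  refine ⟨fun h => ?_, fun h => ?_, fun h => ?_, fun h => ?_⟩
  · exact ⟨DCCOn.finite_of_mem_iff_ne h E.one _ E.one_mem_leftAnnihilator_iff
        (isLeftIdealIn_top_iInf_leftAnnihilator E.one),
      fun a => DCCOn.of_leftInverse h (J := leftExtension (E.one a)) (C := E.hom a a)
        (leftExtension_mono _) (fun I _ => isLeftIdealIn_top_leftExtension _ I)
        (E.leftExtension_inf_hom a)⟩
  · exact ⟨DCCOn.finite_of_mem_iff_ne h E.one _ E.one_mem_rightAnnihilator_iff
        (isRightIdealIn_top_iInf_rightAnnihilator E.one),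
      fun a => DCCOn.of_leftInverse h (J := rightExtension (E.one a)) (C := E.hom a a)
        (rightExtension_mono _) (fun I _ => isRightIdealIn_top_rightExtension _ I)
        (E.rightExtension_inf_hom a)⟩
  · exact ⟨ACCOn.finite_of_mem_iff_ne h E.one _ E.one_mem_leftAnnihilator_iff
        (isLeftIdealIn_top_iInf_leftAnnihilator E.one),
      fun a => ACCOn.of_leftInverse h (J := leftExtension (E.one a)) (C := E.hom a a)
        (leftExtension_mono _) (fun I _ => isLeftIdealIn_top_leftExtension _ I)
        (E.leftExtension_inf_hom a)⟩
  · exact ⟨ACCOn.finite_of_mem_iff_ne h E.one _ E.one_mem_rightAnnihilator_iff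
        (isRightIdealIn_top_iInf_rightAnnihilator E.one),
      fun a => ACCOn.of_leftInverse h (J := rightExtension (E.one a)) (C := E.hom a a)
        (rightExtension_mono _) (fun I _ => isRightIdealIn_top_rightExtension _ I)
        (E.rightExtension_inf_hom a)⟩

end ChainPaper
end
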